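/- Assume ρ ∉ 𝒫 and let θ ∈ ℝ_{≥0}^Q with Σ_q θ_q = 1 be a fairness criterion. There exists a diagonal Q×Q matrix D with D_{qq} > 0 for every q such that, under the MaxWeight policy with weight matrix D, lim_{t→∞} X_q(t)/(Σ_k X_k(t)) = θ_q for every q, if and only if there exist η ∈ ℝ_{≥0}^Q with η ≠ 0, coefficients α_m ≥ 0 with Σ_{m=1}^N α_m = 1, and v ∈ ℝ_{≥0}^Q with v_q = 0 if and only if θ_q = 0, such that: (1) η = (ρ − Σ_{m=1}^N α_m S_m)⁺; (2) for every m with α_m > 0, ⟨v, S_m⟩ ≥ ⟨v, S_k⟩ for every k ∈ {1,…,N}; and (3) θ_q = η_q/(Σ_k η_k) for every q. -/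

import Mathlib

open Finset Filter Topology

/-- The stability region: loads dominated by a convex combination of service vectors. -/
def stabRegion {Q N : ℕ} (S : Fin N → Fin Q → ℝ) : Set (Fin Q → ℝ) :=
  {r | (∀ q, 0 ≤ r q) ∧ ∃ α : Fin N → ℝ, (∀ i, 0 ≤ α i) ∧ (∑ i, α i) = 1 ∧
    ∀ q, r q ≤ ∑ i, α i * S i q}

theorem mw_drift_pt (x s S ρ η B t d K : ℝ) (hx : 0 ≤ x) (hS : 0 ≤ S) (ht : 0 ≤ t) (hd : 0 < d)
    (hη : η = max (ρ - s) 0) (hK : ρ + S + η ≤ K) (hρ : 0 ≤ ρ) :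
    d * (2 * (x - t * η - B) * (ρ - min S x - η) + (ρ - min S x - η) ^ 2) ≤
      2 * (s * (d * x) - S * (d * x)) - 2 * t * ((d * η) * s - (d * η) * S)
        + (d * (2 * K ^ 2 + K ^ 2) + (2 * d * K) * |B|) := by
  have hη0 : 0 ≤ η := hη ▸ le_max_right _ _
  have h1 : ρ - s - η ≤ 0 := by have := le_max_left (ρ - s) 0; linarith
  have h2 : η * (ρ - s - η) = 0 := by
    rcases max_cases (ρ - s) 0 with h | h
    · rw [hη, h.1]; ring
    · rw [hη, h.1]; ring
  set D := min S x with hD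
  have hD0 : 0 ≤ D := le_min hS hx
  have hDS : D ≤ S := min_le_left _ _
  have h3 : x * S - x * D ≤ S ^ 2 := by
    rcases min_cases S x with h | h
    · rw [hD, h.1]; nlinarith
    · rw [hD, h.1]; nlinarith
  have hSK : S ^ 2 ≤ K ^ 2 := by apply pow_le_pow_left₀ hS; linarith
  have hwabs : |ρ - D - η| ≤ K := abs_le.2 ⟨by linarith, by linarith⟩
  have hw2 : (ρ - D - η) ^ 2 ≤ K ^ 2 := by
    rw [← sq_abs]; exact pow_le_pow_left₀ (abs_nonneg _) hwabs 2
  have h4 : - B * (ρ - D - η) ≤ K * |B| := by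
    calc - B * (ρ - D - η) ≤ |- B * (ρ - D - η)| := le_abs_self _
      _ = |B| * |ρ - D - η| := by rw [abs_mul, abs_neg]
      _ ≤ |B| * K := mul_le_mul_of_nonneg_left hwabs (abs_nonneg _)
      _ = K * |B| := mul_comm _ _
  have h5 : x * (ρ - s - η) ≤ 0 := mul_nonpos_of_nonneg_of_nonpos hx h1
  have h6 : t * η * D ≤ t * η * S := mul_le_mul_of_nonneg_left hDS (mul_nonneg ht hη0)
  have h7 : t * (η * (ρ - s - η)) = 0 := by rw [h2, mul_zero]
  have key : 2 * (x - t * η - B) * (ρ - D - η) + (ρ - D - η) ^ 2 ≤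
      2 * (s * x - S * x) - 2 * t * (η * s - η * S) + ((2 * K ^ 2 + K ^ 2) + (2 * K) * |B|) := by
    have e : (x - t * η - B) * (ρ - D - η) = x * (ρ - s - η) + x * s - x * D
        - t * (η * (ρ - s - η)) - t * η * s + t * η * D + (- B * (ρ - D - η)) := by ring
    rw [mul_assoc 2, e]
    nlinarith
  have := mul_le_mul_of_nonneg_left key hd.le
  refine this.trans (le_of_eq ?_)
  ring

theorem mw_core {Q N : ℕ}
    (A : ℕ → Fin Q → ℝ) (hA0 : ∀ t q, 0 ≤ A t q)
    (ρ : Fin Q → ℝ) (hρpos : ∀ q, 0 < ρ q)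
    (hρ : ∀ q, Tendsto (fun t : ℕ => (∑ s ∈ Finset.range t, A s q) / (t : ℝ))
      atTop (𝓝 (ρ q)))
    (S : Fin N → Fin Q → ℝ) (hS : ∀ i q, 0 ≤ S i q)
    (d : Fin Q → ℝ) (hd : ∀ q, 0 < d q)
    (η : Fin Q → ℝ) (α : Fin N → ℝ) (hα : ∀ m, 0 ≤ α m) (hα1 : ∑ m, α m = 1)
    (hη : ∀ q, η q = max (ρ q - ∑ m, α m * S m q) 0)
    (hmax : ∀ k, ∑ q, (d q * η q) * S k q ≤ ∑ q, (d q * η q) * ∑ m, α m * S m q)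
    (σ : ℕ → Fin N) (X : ℕ → Fin Q → ℝ)
    (hX0 : ∀ q, X 0 q = 0)
    (hX : ∀ t q, X (t + 1) q = X t q + A t q - min (S (σ t) q) (X t q))
    (hMW : ∀ t j, ∑ q, S j q * (d q * X t q) ≤ ∑ q, S (σ t) q * (d q * X t q)) (q : Fin Q) :
    Tendsto (fun t : ℕ => X t q / (t : ℝ)) atTop (𝓝 (η q)) := by
  have hXn : ∀ t q, 0 ≤ X t q := by
    intro t
    induction t with
    | zero => intro q; rw [hX0]
    | succ t ih =>
      intro q
      rw [hX]
      have := min_le_right (S (σ t) q) (X t q)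
      have := hA0 t q
      linarith
  set s : Fin Q → ℝ := fun q => ∑ m, α m * S m q with hs
  set B : ℕ → Fin Q → ℝ := fun t q => (∑ u ∈ Finset.range t, A u q) - t * ρ q with hB
  set K : Fin Q → ℝ := fun q => ρ q + (∑ i, S i q) + η q with hK
  set a : ℕ → ℝ := fun t => ∑ q, (d q * (2 * K q ^ 2 + K q ^ 2) + (2 * d q * K q) * |B t q|) with ha
  set Z : ℕ → Fin Q → ℝ := fun t q => X t q - t * η q - B t q with hZ
  have hη0 : ∀ q, 0 ≤ η q := fun q => hη q ▸ le_max_right _ _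
  have hK0 : ∀ q, 0 ≤ K q := fun q => by
    have := Finset.sum_nonneg (fun i (_ : i ∈ Finset.univ) => hS i q)
    have := hη0 q; have := hρpos q
    simp only [hK]; linarith
  have hZs : ∀ t q, Z (t + 1) q = Z t q + (ρ q - min (S (σ t) q) (X t q) - η q) := by
    intro t q
    simp only [hZ, hB, hX, Finset.sum_range_succ]
    push_cast; ring
  have hstep : ∀ t, ∑ q, d q * Z (t + 1) q ^ 2 ≤ ∑ q, d q * Z t q ^ 2 + a t := by
    intro t
    have h1 : ∀ q ∈ Finset.univ, d q * Z (t + 1) q ^ 2 ≤ d q * Z t q ^ 2 +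
      (2 * (s q * (d q * X t q) - S (σ t) q * (d q * X t q))
        - 2 * (t : ℝ) * ((d q * η q) * s q - (d q * η q) * S (σ t) q)
        + (d q * (2 * K q ^ 2 + K q ^ 2) + (2 * d q * K q) * |B t q|)) := by
      intro q _
      have hSK : ρ q + S (σ t) q + η q ≤ K q := by
        have := Finset.single_le_sum (fun i _ => hS i q) (Finset.mem_univ (σ t))
        simp only [hK]; linarith
      have := mw_drift_pt (X t q) (s q) (S (σ t) q) (ρ q) (η q) (B t q) t (d q) (K q) (hXn t q)
        (hS _ _) (Nat.cast_nonneg t) (hd q) (hη q) hSK (hρpos q).le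
      rw [hZs]
      have e : Z t q = X t q - t * η q - B t q := rfl
      rw [← e] at this
      linarith
    have h2 := Finset.sum_le_sum h1
    simp only [Finset.sum_add_distrib, Finset.sum_sub_distrib, ← Finset.mul_sum] at h2
    have h3 : ∑ q, s q * (d q * X t q) ≤ ∑ q, S (σ t) q * (d q * X t q) := by
      have e : ∑ q, s q * (d q * X t q) = ∑ m, α m * ∑ q, S m q * (d q * X t q) := by
        simp only [hs, Finset.sum_mul, Finset.mul_sum]
        rw [Finset.sum_comm]
        simp only [mul_assoc]
      rw [e]
      calc _ ≤ ∑ m, α m * ∑ q, S (σ t) q * (d q * X t q) :=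
            Finset.sum_le_sum fun m _ => mul_le_mul_of_nonneg_left (hMW t m) (hα m)
        _ = _ := by rw [← Finset.sum_mul, hα1, one_mul]
    have h4 := mul_nonneg (Nat.cast_nonneg (α := ℝ) t) (sub_nonneg.2 (hmax (σ t)))
    have h5 : a t = ∑ q, d q * (2 * K q ^ 2 + K q ^ 2) + ∑ q, (2 * d q * K q) * |B t q| := by
      simp only [ha, Finset.sum_add_distrib]
    rw [h5]
    linarith
  have hV : ∀ t, ∑ q, d q * Z t q ^ 2 ≤ ∑ u ∈ Finset.range t, a u := by
    intro t
    induction t with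
    | zero => simp [hZ, hB, hX0]
    | succ t ih => rw [Finset.sum_range_succ]; linarith [hstep t]
  have hBt : ∀ q, Tendsto (fun t : ℕ => B t q / (t : ℝ)) atTop (𝓝 0) := by
    intro q
    have h := (hρ q).sub_const (ρ q)
    rw [sub_self] at h
    refine h.congr' ?_
    filter_upwards [eventually_gt_atTop 0] with t ht
    have : (t : ℝ) ≠ 0 := by positivity
    simp only [hB]; field_simp
  have hBt1 : ∀ q, Tendsto (fun t : ℕ => |B t q| / ((t : ℝ) + 1)) atTop (𝓝 0) := by
    intro q
    have h := (hBt q).abs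
    rw [abs_zero] at h
    refine tendsto_of_tendsto_of_tendsto_of_le_of_le' tendsto_const_nhds h
      (Eventually.of_forall fun t => by positivity) ?_
    filter_upwards [eventually_gt_atTop 0] with t ht
    have : (0 : ℝ) < t := by positivity
    rw [abs_div, abs_of_pos this]
    gcongr
    linarith
  have h1t : Tendsto (fun t : ℕ => 1 / ((t : ℝ) + 1)) atTop (𝓝 0) :=
    tendsto_one_div_add_atTop_nhds_zero_nat
  have hu : Tendsto (fun t : ℕ => a t / ((t : ℝ) + 1)) atTop (𝓝 0) := by
    have h : Tendsto (fun t : ℕ => ∑ q, (d q * (2 * K q ^ 2 + K q ^ 2) * (1 / ((t : ℝ) + 1))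
        + (2 * d q * K q) * (|B t q| / ((t : ℝ) + 1)))) atTop
        (𝓝 (∑ q, (d q * (2 * K q ^ 2 + K q ^ 2) * 0 + (2 * d q * K q) * 0))) :=
      tendsto_finsetSum _ fun q _ => (h1t.const_mul _).add ((hBt1 q).const_mul _)
    simp only [mul_zero, add_zero, Finset.sum_const_zero] at h
    refine h.congr fun t => ?_
    simp only [ha, Finset.sum_div]
    refine Finset.sum_congr rfl fun q _ => ?_
    ring
  have hces := hu.cesaro
  have ha0 : ∀ t, 0 ≤ a t := fun t => Finset.sum_nonneg fun q _ => by
    have := hK0 q; have := (hd q).le; positivity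
  have hZ2 : Tendsto (fun t : ℕ => (Z t q / t) ^ 2) atTop (𝓝 0) := by
    have h := hces.const_mul (1 / d q)
    rw [mul_zero] at h
    refine tendsto_of_tendsto_of_tendsto_of_le_of_le' tendsto_const_nhds h
      (Eventually.of_forall fun t => by positivity) ?_
    filter_upwards [eventually_gt_atTop 0] with t ht
    have htp : (0 : ℝ) < t := by positivity
    have h1 : d q * Z t q ^ 2 ≤ ∑ q, d q * Z t q ^ 2 :=
      Finset.single_le_sum (f := fun q => d q * Z t q ^ 2)
        (fun i _ => mul_nonneg (hd i).le (sq_nonneg _)) (Finset.mem_univ q)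
    have h2 : ∑ u ∈ Finset.range t, a u ≤ t * ∑ u ∈ Finset.range t, a u / ((u : ℝ) + 1) := by
      rw [Finset.mul_sum]
      refine Finset.sum_le_sum fun u hu => ?_
      have hut : (u : ℝ) + 1 ≤ t := by exact_mod_cast Finset.mem_range.1 hu
      have hup : (0 : ℝ) < (u : ℝ) + 1 := by positivity
      rw [← mul_div_assoc, le_div_iff₀ hup, mul_comm]
      exact mul_le_mul_of_nonneg_right hut (ha0 u)
    have h3 := h1.trans ((hV t).trans h2)
    have hdq := hd q
    rw [div_pow, div_le_iff₀ (by positivity)]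
    have : 1 / d q * ((t : ℝ)⁻¹ * ∑ u ∈ Finset.range t, a u / ((u : ℝ) + 1)) * (t : ℝ) ^ 2
      = (t * ∑ u ∈ Finset.range t, a u / ((u : ℝ) + 1)) / d q := by field_simp
    rw [this, le_div_iff₀ hdq]
    linarith
  have hZ1 : Tendsto (fun t : ℕ => Z t q / t) atTop (𝓝 0) := by
    have h := (Real.continuous_sqrt.tendsto 0).comp hZ2
    rw [Real.sqrt_zero] at h
    rw [tendsto_zero_iff_abs_tendsto_zero]
    refine h.congr fun t => ?_
    simp [Function.comp, Real.sqrt_sq_eq_abs]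
  have hfin := (hZ1.add (hBt q)).add_const (η q)
  simp only [zero_add] at hfin
  refine hfin.congr' ?_
  filter_upwards [eventually_gt_atTop 0] with t ht
  have : (t : ℝ) ≠ 0 := by positivity
  simp only [hZ]; field_simp; ring

theorem mw_ratio {Q : ℕ} (X : ℕ → Fin Q → ℝ) (η : Fin Q → ℝ) (h0 : ∑ k, η k ≠ 0)
    (h : ∀ q, Tendsto (fun t : ℕ => X t q / (t : ℝ)) atTop (𝓝 (η q))) (q : Fin Q) :
    Tendsto (fun t : ℕ => X t q / ∑ k, X t k) atTop (𝓝 (η q / ∑ k, η k)) := by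
  have h1 : Tendsto (fun t : ℕ => ∑ k, X t k / (t : ℝ)) atTop (𝓝 (∑ k, η k)) :=
    tendsto_finsetSum _ fun k _ => h k
  refine ((h q).div h1 h0).congr' ?_
  filter_upwards [eventually_gt_atTop 0] with t ht
  have : (t : ℝ) ≠ 0 := by positivity
  simp only [Pi.div_apply]
  rw [← Finset.sum_div, div_div_div_cancel_right₀ this]

theorem mw_sq_bound (x h : ℝ) : max (x + h) 0 ^ 2 ≤ max x 0 ^ 2 + 2 * max x 0 * h + h ^ 2 := by
  rcases max_cases (x + h) 0 with h1 | h1 <;> rcases max_cases x 0 with h2 | h2 <;>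
    rw [h1.1, h2.1] <;> nlinarith [sq_nonneg (x + h), sq_nonneg h]

theorem mw_exists {Q N : ℕ} (hN : 0 < N) (ρ : Fin Q → ℝ) (S : Fin N → Fin Q → ℝ)
    (d : Fin Q → ℝ) (hd : ∀ q, 0 < d q) :
    ∃ α : Fin N → ℝ, (∀ m, 0 ≤ α m) ∧ (∑ m, α m = 1) ∧
      ∀ k, ∑ q, (d q * max (ρ q - ∑ m, α m * S m q) 0) * S k q ≤
        ∑ q, (d q * max (ρ q - ∑ m, α m * S m q) 0) * ∑ m, α m * S m q := by
  have hcont : Continuous (fun α : Fin N → ℝ =>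
      ∑ q, d q * max (ρ q - ∑ m, α m * S m q) 0 ^ 2) := by fun_prop
  have hne : (stdSimplex ℝ (Fin N)).Nonempty := ⟨_, single_mem_stdSimplex ℝ (⟨0, hN⟩ : Fin N)⟩
  obtain ⟨α, hα, hmin⟩ := (isCompact_stdSimplex ℝ (Fin N)).exists_isMinOn hne hcont.continuousOn
  refine ⟨α, hα.1, hα.2, fun k => ?_⟩
  set s : Fin Q → ℝ := fun q => ∑ m, α m * S m q with hs
  set G := ∑ q, (d q * max (ρ q - s q) 0) * (S k q - s q) with hG
  set C := ∑ q, d q * (S k q - s q) ^ 2 with hC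
  have hC0 : 0 ≤ C := Finset.sum_nonneg fun q _ => mul_nonneg (hd q).le (sq_nonneg _)
  have key : ∀ ε : ℝ, 0 < ε → ε ≤ 1 → 2 * G ≤ ε * C := by
    intro ε h0 h1
    have hmem : (1 - ε) • α + ε • (Pi.single k 1 : Fin N → ℝ) ∈ stdSimplex ℝ (Fin N) :=
      convex_stdSimplex ℝ (Fin N) hα (single_mem_stdSimplex ℝ k) (by linarith) h0.le (by ring)
    have h2 := isMinOn_iff.1 hmin _ hmem
    have e : ∀ q, ρ q - ∑ m, ((1 - ε) • α + ε • (Pi.single k 1 : Fin N → ℝ)) m * S m q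
        = (ρ q - s q) + (- ε * (S k q - s q)) := by
      intro q
      have : ∑ m, ((1 - ε) • α + ε • (Pi.single k 1 : Fin N → ℝ)) m * S m q
          = (1 - ε) * s q + ε * S k q := by
        simp only [Pi.add_apply, Pi.smul_apply, smul_eq_mul, add_mul, Finset.sum_add_distrib,
          mul_assoc, ← Finset.mul_sum, hs]
        congr 2
        simp [Pi.single_apply]
      rw [this]; ring
    simp only [e] at h2
    have h3 : ∑ q, d q * max ((ρ q - s q) + (- ε * (S k q - s q))) 0 ^ 2 ≤
        ∑ q, (d q * max (ρ q - s q) 0 ^ 2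
          - (2 * ε) * ((d q * max (ρ q - s q) 0) * (S k q - s q))
          + ε ^ 2 * (d q * (S k q - s q) ^ 2)) := by
      refine Finset.sum_le_sum fun q _ => ?_
      refine (mul_le_mul_of_nonneg_left (mw_sq_bound _ _) (hd q).le).trans (le_of_eq ?_)
      ring
    rw [Finset.sum_add_distrib, Finset.sum_sub_distrib, ← Finset.mul_sum, ← Finset.mul_sum,
      ← hG, ← hC] at h3
    have h4 := h2.trans h3
    have h5 : ε * (2 * G) ≤ ε * (ε * C) := by
      simp only [hs] at h4 ⊢
      nlinarith
    exact le_of_mul_le_mul_left h5 h0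
  have hG0 : G ≤ 0 := by
    by_contra hcon
    push Not at hcon
    have h1 := key (min 1 (G / (C + 1))) (by positivity) (min_le_left _ _)
    have h2 : min 1 (G / (C + 1)) * C ≤ G / (C + 1) * C :=
      mul_le_mul_of_nonneg_right (min_le_right _ _) hC0
    have h3 : G / (C + 1) * C ≤ G := by
      rw [div_mul_eq_mul_div, div_le_iff₀ (by positivity)]; nlinarith
    linarith
  simp only [hG, mul_sub, Finset.sum_sub_distrib] at hG0
  linarith

theorem mw_traj {Q N : ℕ} (hN : 0 < N) (A : ℕ → Fin Q → ℝ) (S : Fin N → Fin Q → ℝ)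
    (d : Fin Q → ℝ) : ∃ (σ : ℕ → Fin N) (X : ℕ → Fin Q → ℝ),
        (∀ q, X 0 q = 0) ∧
        (∀ t q, X (t + 1) q = X t q + A t q - min (S (σ t) q) (X t q)) ∧
        (∀ t j, ∑ q, S j q * (d q * X t q) ≤ ∑ q, S (σ t) q * (d q * X t q)) := by
  haveI : Nonempty (Fin N) := ⟨⟨0, hN⟩⟩
  have h : ∀ x : Fin Q → ℝ, ∃ i, ∀ j, ∑ q, S j q * (d q * x q) ≤ ∑ q, S i q * (d q * x q) :=
    fun x => Finite.exists_max (fun i => ∑ q, S i q * (d q * x q))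
  choose f hf using h
  let X : ℕ → Fin Q → ℝ := fun t => Nat.rec (fun _ => 0)
    (fun t x q => x q + A t q - min (S (f x) q) (x q)) t
  exact ⟨fun t => f (X t), X, fun _ => rfl, fun _ _ => rfl, fun t => hf (X t)⟩

/-- feasibility of a fairness criterion θ via MaxWeight: there exists a
weight matrix D under which X_q(t)/Σ_k X_k(t) → θ_q for all q iff there are η ≠ 0,
α ≥ 0 summing to 1, and v ≥ 0 with supp(v) = supp(θ) satisfying the three conditions. -/
theorem stmt16 {Q N : ℕ} (hQ : 0 < Q) (hN : 0 < N)
    (A : ℕ → Fin Q → ℝ) (Abar : Fin Q → ℝ)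
    (hA0 : ∀ t q, 0 ≤ A t q) (hAbar : ∀ t q, A t q ≤ Abar q)
    (ρ : Fin Q → ℝ) (hρpos : ∀ q, 0 < ρ q)
    (hρ : ∀ q, Tendsto (fun t : ℕ => (∑ s ∈ Finset.range t, A s q) / (t : ℝ))
      atTop (𝓝 (ρ q)))
    (S : Fin N → Fin Q → ℝ) (hS : ∀ i q, 0 ≤ S i q)
    (hover : ρ ∉ stabRegion S)
    (θ : Fin Q → ℝ) (hθ0 : ∀ q, 0 ≤ θ q) (hθ1 : (∑ q, θ q) = 1) :
    (∃ d : Fin Q → ℝ, (∀ q, 0 < d q) ∧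
      ∀ (σ : ℕ → Fin N) (X : ℕ → Fin Q → ℝ),
        (∀ q, X 0 q = 0) →
        (∀ t q, X (t + 1) q = X t q + A t q - min (S (σ t) q) (X t q)) →
        (∀ t j, ∑ q, S j q * (d q * X t q) ≤ ∑ q, S (σ t) q * (d q * X t q)) →
        ∀ q, Tendsto (fun t : ℕ => X t q / ∑ k, X t k) atTop (𝓝 (θ q))) ↔
    (∃ η : Fin Q → ℝ, (∀ q, 0 ≤ η q) ∧ η ≠ 0 ∧
      ∃ α : Fin N → ℝ, (∀ m, 0 ≤ α m) ∧ (∑ m, α m) = 1 ∧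
        ∃ v : Fin Q → ℝ, (∀ q, 0 ≤ v q) ∧ (∀ q, v q = 0 ↔ θ q = 0) ∧
          (∀ q, η q = max (ρ q - ∑ m, α m * S m q) 0) ∧
          (∀ m, 0 < α m → ∀ k, ∑ q, v q * S k q ≤ ∑ q, v q * S m q) ∧
          (∀ q, θ q = η q / ∑ k, η k)) := by
  constructor
  · rintro ⟨d, hd, h⟩
    obtain ⟨α, hα, hα1, hmax⟩ := mw_exists hN ρ S d hd
    obtain ⟨σ, X, h0, hX, hMW⟩ := mw_traj hN A S d
    set η : Fin Q → ℝ := fun q => max (ρ q - ∑ m, α m * S m q) 0 with hη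
    have hη0 : ∀ q, 0 ≤ η q := fun q => le_max_right _ _
    have hne : η ≠ 0 := by
      intro h0
      refine hover ⟨fun q => (hρpos q).le, α, hα, hα1, fun q => ?_⟩
      have h1 : η q = 0 := congrFun h0 q
      have h2 : ρ q - ∑ m, α m * S m q ≤ η q := le_max_left _ _
      linarith
    have hsum : ∑ k, η k ≠ 0 := by
      intro h0
      rw [Finset.sum_eq_zero_iff_of_nonneg fun q _ => hη0 q] at h0
      exact hne (funext fun q => h0 q (Finset.mem_univ q))
    have hlim := mw_core A hA0 ρ hρpos hρ S hS d hd η α hα hα1 (fun _ => rfl) hmax σ X h0 hX hMW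
    have hθ : ∀ q, θ q = η q / ∑ k, η k := fun q =>
      tendsto_nhds_unique (h σ X h0 hX hMW q) (mw_ratio X η hsum hlim q)
    refine ⟨η, hη0, hne, α, hα, hα1, fun q => d q * η q, fun q => mul_nonneg (hd q).le (hη0 q),
      fun q => ?_, fun _ => rfl, fun m hm k => ?_, hθ⟩
    · rw [hθ q, div_eq_zero_iff, mul_eq_zero]
      simp [hsum, (hd q).ne']
    · refine (hmax k).trans ?_
      set M := ∑ q, (d q * η q) * ∑ m, α m * S m q with hM
      have e : ∑ m, α m * (M - ∑ q, (d q * η q) * S m q) = 0 := by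
        have e1 : M = ∑ m, α m * ∑ q, (d q * η q) * S m q := by
          simp only [hM, Finset.mul_sum]
          rw [Finset.sum_comm]
          refine Finset.sum_congr rfl fun _ _ => Finset.sum_congr rfl fun _ _ => by ring
        simp only [mul_sub, Finset.sum_sub_distrib]
        rw [← Finset.sum_mul, hα1, one_mul, ← e1, sub_self]
      have e2 := (Finset.sum_eq_zero_iff_of_nonneg fun m _ =>
        mul_nonneg (hα m) (sub_nonneg.2 (hmax m))).1 e m (Finset.mem_univ m)
      have e3 := (mul_eq_zero.1 e2).resolve_left hm.ne'
      exact (sub_eq_zero.1 e3).le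
  · rintro ⟨η, hη0, hne, α, hα, hα1, v, hv0, hv, hη, hmax, hθ⟩
    have hsum : ∑ k, η k ≠ 0 := by
      intro h0
      rw [Finset.sum_eq_zero_iff_of_nonneg fun q _ => hη0 q] at h0
      exact hne (funext fun q => h0 q (Finset.mem_univ q))
    have hvη : ∀ q, v q = 0 ↔ η q = 0 := fun q => by
      rw [hv q, hθ q, div_eq_zero_iff]; simp [hsum]
    have hex : ∀ q, ∃ c : ℝ, 0 < c ∧ c * η q = v q := by
      intro q
      by_cases h : η q = 0
      · exact ⟨1, one_pos, by rw [h, (hvη q).2 h, mul_zero]⟩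
      · refine ⟨v q / η q, div_pos ?_ ?_, div_mul_cancel₀ _ h⟩
        · exact lt_of_le_of_ne (hv0 q) (fun h' => h ((hvη q).1 h'.symm))
        · exact lt_of_le_of_ne (hη0 q) (Ne.symm h)
    choose d hd hdv using hex
    refine ⟨d, hd, fun σ X h0 hX hMW q => ?_⟩
    rw [hθ q]
    refine mw_ratio X η hsum (mw_core A hA0 ρ hρpos hρ S hS d hd η α hα hα1 hη (fun k => ?_)
      σ X h0 hX hMW) q
    simp only [hdv]
    have e1 : ∑ q, v q * ∑ m, α m * S m q = ∑ m, α m * ∑ q, v q * S m q := by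
      simp only [Finset.mul_sum]
      rw [Finset.sum_comm]
      refine Finset.sum_congr rfl fun _ _ => Finset.sum_congr rfl fun _ _ => by ring
    rw [e1]
    calc _ = ∑ m, α m * ∑ q, v q * S k q := by rw [← Finset.sum_mul, hα1, one_mul]
      _ ≤ _ := Finset.sum_le_sum fun m _ => by
        rcases (hα m).eq_or_lt with h | h
        · rw [← h, zero_mul, zero_mul]
        · exact mul_le_mul_of_nonneg_left (hmax m h k) (hα m)
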